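/- Let G be a minimal counterexample. Then G contains no 3⁺-thread, i.e., no ℓ-thread with ℓ ≥ 3. -/

import Mathlib

open SimpleGraph

noncomputable def edgeCount {V : Type*} (G : SimpleGraph V) : ℕ := Nat.card G.edgeSet

noncomputable def deg {V : Type*} (G : SimpleGraph V) (v : V) : ℕ := Nat.card (G.neighborSet v)

def TwoIndependent {V : Type*} (G : SimpleGraph V) (S : Set V) : Prop :=
  ∀ u ∈ S, ∀ v ∈ S, u ≠ v → ¬ G.Adj u v ∧ ∀ w, ¬ (G.Adj u w ∧ G.Adj w v)

def IsIFPartition {V : Type*} (G : SimpleGraph V) (A B : Set V) : Prop :=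
  A ∪ B = Set.univ ∧ Disjoint A B ∧ TwoIndependent G A ∧ (G.induce B).IsAcyclic

def IsAssignment {V : Type*} (I F U : Set V) : Prop :=
  I ∪ F ∪ U = Set.univ ∧ Disjoint I F ∧ Disjoint I U ∧ Disjoint F U

noncomputable def rho {V : Type*} (G : SimpleGraph V) (I F U : Set V) (H : G.Subgraph) : ℤ :=
  (H.verts ∩ I).ncard + 4 * (H.verts ∩ F).ncard + 5 * (H.verts ∩ U).ncard
    - 4 * Nat.card H.edgeSet

noncomputable def rhoSet {V : Type*} (G : SimpleGraph V) (I F U : Set V) (S : Set V) : ℤ :=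
  (S ∩ I).ncard + 4 * (S ∩ F).ncard + 5 * (S ∩ U).ncard - 4 * edgeCount (G.induce S)

def IsCounterexample {V : Type*} [Fintype V] (G : SimpleGraph V) (I F U : Set V) : Prop :=
  IsAssignment I F U ∧
  (∀ H : G.Subgraph, H.verts.Nonempty → 0 < rho G I F U H) ∧
  ¬ ∃ A B : Set V, IsIFPartition G A B ∧ I ⊆ A ∧ F ⊆ B

def IsMinCounterexample {V : Type*} [Fintype V] (G : SimpleGraph V) (I F U : Set V) : Prop :=
  IsCounterexample G I F U ∧
  ∀ (n : ℕ) (G' : SimpleGraph (Fin n)) (I' F' U' : Set (Fin n)),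
    IsCounterexample G' I' F' U' →
    Fintype.card V + edgeCount G ≤ n + edgeCount G'

def IsThread {V : Type*} (G : SimpleGraph V) (I F U : Set V) (p : List V) : Prop :=
  p ≠ [] ∧ p.Nodup ∧ p.Chain' G.Adj ∧ (∀ v ∈ p, v ∈ U ∧ deg G v = 2) ∧
  (∀ w, w ∉ p → (∃ a ∈ p, G.Adj a w) → 3 ≤ deg G w ∨ w ∈ I ∪ F)

def BordersThread {V : Type*} (G : SimpleGraph V) (p : List V) (w : V) : Prop :=
  w ∉ p ∧ ∃ a ∈ p, G.Adj a w

def IsStarForest {V : Type*} (H : SimpleGraph V) : Prop :=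
  H.IsAcyclic ∧ ∀ a b c d : V, H.Adj a b → H.Adj b c → H.Adj c d → a = c ∨ b = d

def IsStarColoring {V : Type*} {k : ℕ} (G : SimpleGraph V) (c : V → Fin k) : Prop :=
  (∀ u v, G.Adj u v → c u ≠ c v) ∧
  ∀ i j : Fin k, IsStarForest (G.induce {v | c v = i ∨ c v = j})

def StarColorable {V : Type*} (G : SimpleGraph V) (k : ℕ) : Prop :=
  ∃ c : V → Fin k, IsStarColoring G c

def MadLt {V : Type*} (G : SimpleGraph V) (q : ℚ) : Prop :=
  ∀ H : G.Subgraph, H.verts.Nonempty →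
    (2 * (Nat.card H.edgeSet : ℚ)) / (H.verts.ncard : ℚ) < q

/-- Adding a vertex with at most one neighbour in `B` keeps the induced graph acyclic. -/
lemma acyclic_insert {V : Type*} (G : SimpleGraph V) (B : Set V) (v : V)
    (hB : (G.induce B).IsAcyclic)
    (hv : ∀ u ∈ B, ∀ w ∈ B, G.Adj v u → G.Adj v w → u = w) :
    (G.induce (insert v B)).IsAcyclic := by
  classical
  intro x c hc
  by_cases hmem : ∃ h : v ∈ insert v B, (⟨v, h⟩ : (insert v B : Set V)) ∈ c.support
  · obtain ⟨h, hs⟩ := hmem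
    have hr := Walk.IsCycle.rotate hs hc
    have h1 := (c.rotate _ hs).adj_snd hr.not_nil
    have h2 := (c.rotate _ hs).adj_penultimate hr.not_nil
    have hne := hr.snd_ne_penultimate
    apply hne
    have a1 : G.Adj v (c.rotate _ hs).snd.1 := h1
    have a2 : G.Adj v (c.rotate _ hs).penultimate.1 := h2.symm
    apply Subtype.ext
    apply hv _ _ _ _ a1 a2
    · exact ((c.rotate _ hs).snd.2).resolve_left a1.ne'
    · exact ((c.rotate _ hs).penultimate.2).resolve_left a2.ne'
  · have hc' := (Walk.isCycle_map_iff_of_injective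
      (f := (Embedding.induce (G := G) (insert v B)).toHom)
      (Subtype.val_injective)).2 hc
    have hsup : ∀ y ∈ (c.map (Embedding.induce (G := G) (insert v B)).toHom).support, y ∈ B := by
      intro y hy
      rw [Walk.support_map, List.mem_map] at hy
      obtain ⟨z, hz, rfl⟩ := hy
      refine z.2.resolve_left ?_
      intro hzv
      exact hmem ⟨Set.mem_insert _ _, by
        have : z = ⟨v, Set.mem_insert _ _⟩ := Subtype.ext hzv
        rwa [← this]⟩
    refine hB ((c.map (Embedding.induce (G := G) (insert v B)).toHom).induce B hsup) ?_
    rw [← Walk.isCycle_map_iff_of_injective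
      (f := (Embedding.induce (G := G) B).toHom) (Subtype.val_injective), Walk.map_induce]
    exact hc'

lemma rho_map {V W : Type*} (G : SimpleGraph V) (G' : SimpleGraph W) (I F U : Set V)
    (f : G' ↪g G) (H : G'.Subgraph) :
    rho G I F U (H.map f.toHom) = rho G' (f ⁻¹' I) (f ⁻¹' F) (f ⁻¹' U) H := by
  have key : ∀ X : Set V, ((H.map f.toHom).verts ∩ X).ncard = (H.verts ∩ f ⁻¹' X).ncard := by
    intro X
    have : (H.map f.toHom).verts ∩ X = f '' (H.verts ∩ f ⁻¹' X) := by
      rw [Set.image_inter_preimage]; rfl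
    rw [this, Set.ncard_image_of_injective _ f.injective]
  have he : Nat.card (H.map f.toHom).edgeSet = Nat.card H.edgeSet := by
    rw [Subgraph.edgeSet_map]
    exact Nat.card_image_of_injective (Sym2.map.injective f.injective) _
  unfold rho
  rw [key, key, key, he]

/-- Minimality: every proper vertex subset has a suitable partition. -/
lemma partition_of_proper {V : Type*} [Fintype V] (G : SimpleGraph V)
    (I F U : Set V) (hmin : IsMinCounterexample G I F U) (S : Set V) (hS : S ≠ Set.univ) :
    ∃ A B : Set V, A ∪ B = S ∧ Disjoint A B ∧
      (∀ u ∈ A, ∀ v ∈ A, u ≠ v → ¬ G.Adj u v ∧ ∀ w ∈ S, ¬ (G.Adj u w ∧ G.Adj w v)) ∧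
      (G.induce B).IsAcyclic ∧ I ∩ S ⊆ A ∧ F ∩ S ⊆ B := by
  classical
  obtain ⟨⟨⟨hun, hIF, hIU, hFU⟩, hpot, -⟩, hm⟩ := hmin
  let e : Fin (Fintype.card S) ≃ S := (Fintype.equivFin S).symm
  let g : Fin (Fintype.card S) ↪ V := e.toEmbedding.trans (Function.Embedding.subtype _)
  have hgS : ∀ i, g i ∈ S := fun i => (e i).2
  have hsurj : ∀ v ∈ S, ∃ i, g i = v := fun v hv => ⟨e.symm ⟨v, hv⟩, by simp [g]⟩
  let G' := G.comap g
  let f : G' ↪g G := ⟨g, Iff.rfl⟩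
  have hcard : Fintype.card S < Fintype.card V := by
    obtain ⟨v, hv⟩ := (Set.ne_univ_iff_exists_notMem S).1 hS
    exact Fintype.card_subtype_lt (p := (· ∈ S)) hv
  have hedge : edgeCount G' ≤ edgeCount G :=
    Nat.card_le_card_of_injective _ f.mapEdgeSet.injective
  have hnot : ¬ IsCounterexample G' (g ⁻¹' I) (g ⁻¹' F) (g ⁻¹' U) := by
    intro h
    have := hm _ G' _ _ _ h
    omega
  have hex : ∃ A B, IsIFPartition G' A B ∧ g ⁻¹' I ⊆ A ∧ g ⁻¹' F ⊆ B := by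
    by_contra hcon
    refine hnot ⟨⟨?_, hIF.preimage g, hIU.preimage g, hFU.preimage g⟩, ?_, hcon⟩
    · rw [← Set.preimage_union, ← Set.preimage_union, hun, Set.preimage_univ]
    · intro H hH
      have := hpot (H.map f.toHom) (hH.image _)
      rwa [rho_map] at this
  obtain ⟨A, B, ⟨hAB, hd, hti, hac⟩, hIA, hFB⟩ := hex
  refine ⟨g '' A, g '' B, ?_, ?_, ?_, ?_, ?_, ?_⟩
  · rw [← Set.image_union, hAB, Set.image_univ]
    ext v
    exact ⟨fun ⟨i, hi⟩ => hi ▸ hgS i, hsurj v⟩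
  · exact (Set.disjoint_image_iff g.injective).2 hd
  · rintro _ ⟨i, hi, rfl⟩ _ ⟨j, hj, rfl⟩ hne
    have := hti i hi j hj (fun h => hne (h ▸ rfl))
    refine ⟨this.1, fun w hw => ?_⟩
    obtain ⟨k, rfl⟩ := hsurj w hw
    exact this.2 k
  · have hpre : ∀ x : (g '' B : Set V), ∃ i : B, g i = x := by
      rintro ⟨_, i, hi, rfl⟩; exact ⟨⟨i, hi⟩, rfl⟩
    choose r hr using hpre
    refine hac.comap (⟨r, ?_⟩ : G.induce (g '' B) →g G'.induce B) ?_
    · intro a b hab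
      change G.Adj (g (r a)) (g (r b))
      rw [hr, hr]; exact hab
    · intro a b hab
      apply Subtype.ext
      have hab' : r a = r b := hab
      rw [← hr, ← hr, hab']
  · rintro v ⟨hv, hvS⟩
    obtain ⟨i, rfl⟩ := hsurj v hvS
    exact ⟨i, hIA hv, rfl⟩
  · rintro v ⟨hv, hvS⟩
    obtain ⟨i, rfl⟩ := hsurj v hvS
    exact ⟨i, hFB hv, rfl⟩

/-- A degree two vertex with a known neighbour has all its neighbours in a pair. -/
lemma deg_two_nbrs {V : Type*} [Fintype V] (G : SimpleGraph V) (a b : V)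
    (h : deg G a = 2) (hab : G.Adj a b) : ∃ x, x ≠ b ∧ ∀ w, G.Adj a w ↔ w = b ∨ w = x := by
  have h' : (G.neighborSet a).ncard = 2 := h
  obtain ⟨p, q, hpq, hs⟩ := Set.ncard_eq_two.1 h'
  have hw : ∀ w, G.Adj a w ↔ w = p ∨ w = q := fun w => by
    rw [← mem_neighborSet, hs]; simp
  rcases (hw b).1 hab with rfl | rfl
  · exact ⟨q, hpq.symm, hw⟩
  · exact ⟨p, hpq, fun w => (hw w).trans or_comm⟩

/-- If `x` lies outside `B`, the three path vertices may all be added to the forest. -/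
lemma acyclic_add_three {V : Type*} (G : SimpleGraph V) (B : Set V) (a b c x y : V)
    (hB : (G.induce B).IsAcyclic) (haB : a ∉ B) (hbB : b ∉ B) (hab : a ≠ b) (hac : a ≠ c)
    (hxB : x ∉ B) (hxc : x ≠ c)
    (ha : ∀ w, G.Adj a w ↔ w = b ∨ w = x)
    (hb : ∀ w, G.Adj b w ↔ w = a ∨ w = c)
    (hc : ∀ w, G.Adj c w ↔ w = b ∨ w = y) :
    (G.induce (insert a (insert b (insert c B)))).IsAcyclic := by
  refine acyclic_insert _ _ _ (acyclic_insert _ _ _ (acyclic_insert _ _ _ hB ?_) ?_) ?_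
  · grind
  · simp only [Set.mem_insert_iff]; grind
  · simp only [Set.mem_insert_iff]; grind

set_option maxHeartbeats 1000000 in
/-- (C2) A minimal counterexample contains no `3⁺`-thread. -/
theorem no_three_plus_thread {V : Type*} [Fintype V] (G : SimpleGraph V)
    (I F U : Set V) (hmin : IsMinCounterexample G I F U) :
    ¬ ∃ p : List V, IsThread G I F U p ∧ 3 ≤ p.length := by
  rintro ⟨p, ⟨-, hnd, hch, hU, -⟩, hlen⟩
  match p, hlen with
  | a :: b :: c :: t, _ =>
  have hab : G.Adj a b := by
    have := List.isChain_cons_cons.1 hch; exact this.1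
  have hbc : G.Adj b c := by
    have := List.isChain_cons_cons.1 (List.isChain_cons_cons.1 hch).2; exact this.1
  have hac : a ≠ c := by
    rintro rfl; simp at hnd
  have hUa := hU a (by simp)
  have hUb := hU b (by simp)
  have hUc := hU c (by simp)
  obtain ⟨x, hxb, ha⟩ := deg_two_nbrs G a b hUa.2 hab
  obtain ⟨z, hza, hb⟩ := deg_two_nbrs G b a hUb.2 hab.symm
  obtain ⟨y, hyb, hc⟩ := deg_two_nbrs G c b hUc.2 hbc.symm
  have hzc : z = c := by
    rcases (hb c).1 hbc with h | h
    · exact absurd h.symm hac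
    · exact h.symm
  subst hzc
  obtain ⟨A, B, hABS, hd, hti, hacy, hIA, hFB⟩ := partition_of_proper G I F U hmin
    {v | v ≠ a ∧ v ≠ b ∧ v ≠ z} (by
      intro h
      have : a ∈ ({v | v ≠ a ∧ v ≠ b ∧ v ≠ z} : Set V) := h ▸ Set.mem_univ a
      exact this.1 rfl)
  obtain ⟨⟨⟨hun, hIF, hIU, hFU⟩, -, hno⟩, -⟩ := hmin
  rw [Set.disjoint_left] at hd hIU hFU
  have hS : ∀ v, (v ∈ A ∨ v ∈ B) ↔ (v ≠ a ∧ v ≠ b ∧ v ≠ z) := fun v => by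
    rw [← Set.mem_union, hABS]; rfl
  have hIA' : ∀ v ∈ I, v ∈ A := fun v hv => hIA ⟨hv, by
    refine ⟨?_, ?_, ?_⟩ <;> rintro rfl
    exacts [hIU hv hUa.1, hIU hv hUb.1, hIU hv hUc.1]⟩
  have hFB' : ∀ v ∈ F, v ∈ B := fun v hv => hFB ⟨hv, by
    refine ⟨?_, ?_, ?_⟩ <;> rintro rfl
    exacts [hFU hv hUa.1, hFU hv hUb.1, hFU hv hUc.1]⟩
  have hSa := hS a
  have hSb := hS b
  have hSz := hS z
  have hti' : TwoIndependent G A := by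
    intro u hu v hv huv
    refine ⟨(hti u hu v hv huv).1, fun w hw => ?_⟩
    have hu' := (hS u).1 (Or.inl hu)
    have hv' := (hS v).1 (Or.inl hv)
    by_cases hwS : w ≠ a ∧ w ≠ b ∧ w ≠ z
    · exact (hti u hu v hv huv).2 w hwS hw
    · have h1 := hw.1.symm
      have h2 := hw.2
      by_cases hwa : w = a
      · subst hwa; rw [ha] at h1 h2; grind
      by_cases hwb : w = b
      · subst hwb; rw [hb] at h1 h2; grind
      by_cases hwz : w = z
      · subst hwz; rw [hc] at h1 h2; grind
      exact hwS ⟨hwa, hwb, hwz⟩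
  apply hno
  by_cases hxy : x ∈ A ∨ y ∈ A
  · refine ⟨A, insert a (insert b (insert z B)), ⟨?_, ?_, hti', ?_⟩, hIA', ?_⟩
    · ext v
      have := hS v
      simp only [Set.mem_union, Set.mem_insert_iff, Set.mem_univ, iff_true]
      clear * - this
      grind
    · rw [Set.disjoint_left]
      intro v hv
      have := (hS v).1 (Or.inl hv)
      have h2 := hd hv
      simp only [Set.mem_insert_iff]
      clear * - this h2
      grind
    · rcases hxy with hx | hy
      · have := (hS x).1 (Or.inl hx)
        exact acyclic_add_three G B a b z x y hacy (by grind) (by grind) hab.ne hac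
          (hd hx) this.2.2 ha hb hc
      · have := (hS y).1 (Or.inl hy)
        have h3 := acyclic_add_three G B z b a y x hacy (by grind) (by grind) hbc.ne' hac.symm
          (hd hy) this.1 hc (fun w => (hb w).trans or_comm) ha
        have heq : insert a (insert b (insert z B)) = insert z (insert b (insert a B)) := by
          ext v; simp only [Set.mem_insert_iff]; tauto
        rw [heq]; exact h3
    · intro v hv
      simp only [Set.mem_insert_iff]
      exact Or.inr (Or.inr (Or.inr (hFB' v hv)))
  · rw [not_or] at hxy
    refine ⟨insert b A, insert a (insert z B), ⟨?_, ?_, ?_, ?_⟩, ?_, ?_⟩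
    · ext v
      have := hS v
      simp only [Set.mem_union, Set.mem_insert_iff, Set.mem_univ, iff_true]
      clear * - this
      grind
    · rw [Set.disjoint_left]
      intro v hv
      simp only [Set.mem_insert_iff] at hv ⊢
      have h1 := hab.ne
      have h2 := hbc.ne
      have h3 := hS v
      rcases hv with rfl | hv
      · grind
      · have := hd hv
        tauto
    · have key : ∀ u ∈ A, ¬ G.Adj b u ∧ ∀ w, ¬ (G.Adj b w ∧ G.Adj w u) := by
        intro u hu
        have hu' := (hS u).1 (Or.inl hu)
        refine ⟨fun h => ?_, fun w hw => ?_⟩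
        · rw [hb] at h; tauto
        · obtain ⟨h1, h2⟩ := hw
          rw [hb] at h1
          rcases h1 with rfl | rfl
          · rw [ha] at h2; grind
          · rw [hc] at h2; grind
      intro u hu v hv huv
      rcases hu with rfl | hu <;> rcases hv with rfl | hv
      · exact absurd rfl huv
      · exact key v hv
      · exact ⟨fun h => (key u hu).1 h.symm, fun w hw => (key u hu).2 w ⟨hw.2.symm, hw.1.symm⟩⟩
      · exact hti' u hu v hv huv
    · have h1 := hab.ne
      have h2 := hbc.ne
      refine acyclic_insert _ _ _ (acyclic_insert _ _ _ hacy ?_) ?_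
      · grind
      · simp only [Set.mem_insert_iff]; grind
    · intro v hv
      exact Or.inr (hIA' v hv)
    · intro v hv
      exact Or.inr (Or.inr (hFB' v hv))
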